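/- Consider T tasks with data distributions D_1,…,D_T on Z, samples S_j ∈ Z^{m_j}, and assume the loss satisfies ℓ(h,z) ∈ [0,K]. Fix temperatures λ_1,…,λ_T > 0 and let Q̂^{λ_T}_{1:T} be obtained by iterated empirical Gibbs updates: Q̂^{λ_1}_{1:1} is the empirical Gibbs posterior with prior P, sample S_1 and temperature λ_1, and for j = 2,…,T, Q̂^{λ_j}_{1:j} is the empirical Gibbs posterior with prior Q̂^{λ_{j−1}}_{1:j−1}, sample S_j and temperature λ_j. Fix i ∈ {1,…,T−1} with λ_i = λ_T, and fix the samples S_j for j ≠ i. If S_i is an i.i.d. sample of size m_i from D_i and the empirical task covariance cov_P(i,[T]) = cov_{h∼P}(e^{−λ_T L̂(h,S_i)}, e^{−Σ_{j=1, j≠i}^{T} λ_j L̂(h,S_j)}) is nonnegative for every realization of S_i, then E_{S_i}[L(Q̂^{λ_T}_{1:T}, D_i)] ≤ λ_T K²/(8 m_i) + L(P, D_i). -/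

import Mathlib

open MeasureTheory Real

/-- Expected loss `L(h, D) = E_{z∼D} ℓ(h, z)`. -/
noncomputable def expLoss {H Z : Type*} [MeasurableSpace Z] (ℓ : H → Z → ℝ) (h : H)
    (D : Measure Z) : ℝ :=
  ∫ z, ℓ h z ∂D

/-- Empirical loss `L̂(h, S) = (1/m) ∑_{j=1}^m ℓ(h, z_j)`. -/
noncomputable def empLoss {H Z : Type*} (ℓ : H → Z → ℝ) {m : ℕ} (h : H) (S : Fin m → Z) : ℝ :=
  (∑ j, ℓ h (S j)) / m

/-- The measure with density with respect to `P` proportional to `e^{−g h}`. -/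
noncomputable def gibbs {H : Type*} [MeasurableSpace H] (P : Measure H) (g : H → ℝ) :
    Measure H :=
  P.withDensity fun h => ENNReal.ofReal (Real.exp (-g h) / ∫ h', Real.exp (-g h') ∂P)

/-- Iterated Gibbs updates: `iterGibbs P g n` applies the Gibbs update successively with the
loss functions `g 0, …, g (n−1)`, starting from the prior `P`. -/
noncomputable def iterGibbs {H : Type*} [MeasurableSpace H] (P : Measure H) (g : ℕ → H → ℝ) :
    ℕ → Measure H
  | 0 => P
  | n + 1 => gibbs (iterGibbs P g n) (g n)

theorem gibbs_eq_tilted {H : Type*} [MeasurableSpace H] (P : Measure H) (g : H → ℝ) :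
    gibbs P g = P.tilted fun h => -g h := rfl

theorem iterGibbs_eq_tilted {H : Type*} [MeasurableSpace H] (P : Measure H)
    [IsProbabilityMeasure P] (g : ℕ → H → ℝ) (n : ℕ)
    (hg : ∀ k < n, Integrable (fun h => exp (-∑ j ∈ Finset.range k, g j h)) P) :
    iterGibbs P g n = P.tilted fun h => -∑ j ∈ Finset.range n, g j h := by
  induction n with
  | zero => simp [iterGibbs]
  | succ n ih =>
    rw [iterGibbs, ih fun k hk => hg k (hk.trans n.lt_succ_self), gibbs_eq_tilted,
      tilted_tilted (hg n n.lt_succ_self)]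
    congr 1
    ext h
    simp only [Pi.add_apply, Finset.sum_range_succ]
    ring

theorem integrable_exp_of_mem_Icc {α : Type*} [MeasurableSpace α] {μ : Measure α}
    [IsFiniteMeasure μ] {f : α → ℝ} (hf : Measurable f) {a b : ℝ}
    (hab : ∀ x, f x ∈ Set.Icc a b) : Integrable (fun x => exp (f x)) μ :=
  Integrable.of_mem_Icc (exp a) (exp b) hf.exp.aemeasurable
    (ae_of_all _ fun x => ⟨exp_le_exp.2 (hab x).1, exp_le_exp.2 (hab x).2⟩)

theorem exp_neg_integral_le {α : Type*} [MeasurableSpace α] {μ : Measure α}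
    [IsProbabilityMeasure μ] {f : α → ℝ} (hf : Integrable f μ)
    (hexp : Integrable (fun x => exp (-f x)) μ) :
    exp (-∫ x, f x ∂μ) ≤ ∫ x, exp (-f x) ∂μ := by
  rw [← integral_neg]
  exact convexOn_exp.map_integral_le continuous_exp.continuousOn isClosed_univ
    (ae_of_all _ fun _ => Set.mem_univ _) hf.neg hexp

/-- Change of measure from the Gibbs measure with energy `A + B` to the one with energy `B`, when
`e^{-A}` and `e^{-B}` are nonnegatively correlated under the prior. -/
theorem integral_tilted_add_le_of_cov_nonneg {H : Type*} [MeasurableSpace H] (P : Measure H)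
    [IsProbabilityMeasure P] {A B L : H → ℝ} (hA : Measurable A) (hB : Measurable B)
    (hL : Measurable L) {a b c : ℝ} (hAb : ∀ h, A h ∈ Set.Icc 0 a)
    (hBb : ∀ h, B h ∈ Set.Icc 0 b) (hLb : ∀ h, L h ∈ Set.Icc 0 c)
    (hcov : 0 ≤ (∫ h, exp (-A h) * exp (-B h) ∂P) -
      (∫ h, exp (-A h) ∂P) * ∫ h, exp (-B h) ∂P) (k : ℝ) :
    ∫ h, L h ∂(P.tilted fun h => -(A h + B h)) ≤
      k + (∫ h, A h ∂P) - 1 + exp (-k) * ∫ h, exp (L h - A h) ∂(P.tilted fun h => -B h) := by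
  have hexpA : Integrable (fun h => exp (-A h)) P :=
    integrable_exp_of_mem_Icc hA.neg (a := -a) (b := 0)
      fun h => ⟨by linarith [(hAb h).2], by linarith [(hAb h).1]⟩
  have hexpB : Integrable (fun h => exp (-B h)) P :=
    integrable_exp_of_mem_Icc hB.neg (a := -b) (b := 0)
      fun h => ⟨by linarith [(hBb h).2], by linarith [(hBb h).1]⟩
  have hexpAB : Integrable (fun h => exp (-(A h + B h))) P :=
    integrable_exp_of_mem_Icc (hA.add hB).neg (a := -(a + b)) (b := 0)
      fun h => ⟨by linarith [(hAb h).2, (hBb h).2], by linarith [(hAb h).1, (hBb h).1]⟩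
  have := isProbabilityMeasure_tilted hexpAB
  set Q := P.tilted fun h => -(A h + B h) with hQ
  set ν := P.tilted fun h => -B h with hν
  set M := ∫ h, A h ∂P
  have hLint : Integrable L Q := Integrable.of_mem_Icc 0 c hL.aemeasurable (ae_of_all _ hLb)
  have hexpL : Integrable (fun h => exp (L h)) Q := integrable_exp_of_mem_Icc hL hLb
  have hAint : Integrable A P := Integrable.of_mem_Icc 0 a hA.aemeasurable (ae_of_all _ hAb)
  have hZB : 0 < ∫ h, exp (-B h) ∂P := integral_exp_pos hexpB
  have hZAB : 0 < ∫ h, exp (-(A h + B h)) ∂P := integral_exp_pos hexpAB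
  have hnorm : exp (-M) * ∫ h, exp (-B h) ∂P ≤ ∫ h, exp (-(A h + B h)) ∂P := by
    have h1 := exp_neg_integral_le hAint hexpA
    have h2 : ∫ h, exp (-A h) * exp (-B h) ∂P = ∫ h, exp (-(A h + B h)) ∂P := by
      refine integral_congr_ae (ae_of_all _ fun h => ?_)
      simp only [neg_add, exp_add]
    rw [h2] at hcov
    linarith [mul_le_mul_of_nonneg_right h1 hZB.le]
  have hQexp : exp (-M) * ∫ h, exp (L h) ∂Q ≤ ∫ h, exp (L h - A h) ∂ν := by
    rw [hQ, hν, integral_exp_tilted, integral_exp_tilted]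
    have h2 : ∫ h, exp (((fun h => -(A h + B h)) + L) h) ∂P =
        ∫ h, exp (((fun h => -B h) + fun h => L h - A h) h) ∂P := by
      refine integral_congr_ae (ae_of_all _ fun h => ?_)
      simp only [Pi.add_apply]
      congr 1
      ring
    rw [h2, ← mul_div_assoc, div_le_div_iff₀ hZAB hZB]
    have h3 : 0 ≤ ∫ h, exp (((fun h => -B h) + fun h => L h - A h) h) ∂P :=
      integral_nonneg fun h => (exp_pos _).le
    nlinarith [mul_le_mul_of_nonneg_left hnorm h3]
  have hlin : (∫ h, L h ∂Q) - (k + M) + 1 ≤ exp (-(k + M)) * ∫ h, exp (L h) ∂Q := by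
    have h1 : ∫ h, (L h - (k + M) + 1) ∂Q ≤ ∫ h, exp (-(k + M)) * exp (L h) ∂Q := by
      refine integral_mono ((hLint.sub (integrable_const _)).add (integrable_const _))
        (hexpL.const_mul _) fun h => ?_
      simp only
      rw [← exp_add, neg_add_eq_sub]
      exact add_one_le_exp _
    rw [integral_const_mul] at h1
    have h2 : ∫ h, (L h - (k + M) + 1) ∂Q = (∫ h, L h ∂Q) - (k + M) + 1 := by
      have h3 : Integrable (fun h => L h - (k + M)) Q := hLint.sub (integrable_const _)
      rw [integral_add h3 (integrable_const _), integral_sub hLint (integrable_const _)]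
      simp
    rwa [h2] at h1
  rw [neg_add, exp_add, mul_assoc] at hlin
  linarith [mul_le_mul_of_nonneg_left hQexp (exp_pos (-k)).le]

theorem measurable_expLoss {H Z : Type*} [MeasurableSpace H] [MeasurableSpace Z] {ℓ : H → Z → ℝ}
    (hℓ : Measurable (Function.uncurry ℓ)) (D : Measure Z) [SFinite D] :
    Measurable fun h => expLoss ℓ h D :=
  (StronglyMeasurable.integral_prod_right hℓ.stronglyMeasurable).measurable

theorem measurable_uncurry_empLoss {H Z : Type*} [MeasurableSpace H] [MeasurableSpace Z] {ℓ : H → Z → ℝ}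
    (hℓ : Measurable (Function.uncurry ℓ)) (m : ℕ) :
    Measurable fun p : H × (Fin m → Z) => empLoss ℓ p.1 p.2 := by
  unfold empLoss
  refine (Finset.measurable_sum _ fun j _ => ?_).div_const _
  exact hℓ.comp (measurable_fst.prodMk ((measurable_pi_apply j).comp measurable_snd))

theorem measurable_empLoss {H Z : Type*} [MeasurableSpace H] [MeasurableSpace Z] {ℓ : H → Z → ℝ}
    (hℓ : Measurable (Function.uncurry ℓ)) {m : ℕ} (S : Fin m → Z) :
    Measurable fun h => empLoss ℓ h S :=
  (measurable_uncurry_empLoss hℓ m).comp (measurable_id.prodMk measurable_const)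

theorem expLoss_mem_Icc {H Z : Type*} [MeasurableSpace Z] {ℓ : H → Z → ℝ} {K : ℝ}
    {h : H} (hm : Measurable (ℓ h)) (hb : ∀ z, ℓ h z ∈ Set.Icc 0 K)
    (D : Measure Z) [IsProbabilityMeasure D] : expLoss ℓ h D ∈ Set.Icc 0 K := by
  refine ⟨integral_nonneg fun z => (hb z).1, ?_⟩
  have h1 := integral_mono (Integrable.of_mem_Icc 0 K hm.aemeasurable (ae_of_all D hb))
    (integrable_const K) fun z => (hb z).2
  simpa [expLoss] using h1

theorem empLoss_mem_Icc {H Z : Type*} {ℓ : H → Z → ℝ} {K : ℝ}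
    (hK : 0 ≤ K) {h : H} (hb : ∀ z, ℓ h z ∈ Set.Icc 0 K) {m : ℕ}
    (S : Fin m → Z) : empLoss ℓ h S ∈ Set.Icc 0 K := by
  refine ⟨div_nonneg (Finset.sum_nonneg fun j _ => (hb _).1) m.cast_nonneg,
    div_le_of_le_mul₀ m.cast_nonneg hK ?_⟩
  calc ∑ j, ℓ h (S j) ≤ ∑ _j : Fin m, K := Finset.sum_le_sum fun j _ => (hb _).2
    _ = K * m := by simp [mul_comm]

theorem integral_empLoss {H Z : Type*} [MeasurableSpace Z] {ℓ : H → Z → ℝ} {K : ℝ}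
    {h : H} (hm : Measurable (ℓ h)) (hb : ∀ z, ℓ h z ∈ Set.Icc 0 K)
    (D : Measure Z) [IsProbabilityMeasure D] {m : ℕ} (hm0 : 0 < m) :
    ∫ s, empLoss ℓ h s ∂(Measure.pi fun _ : Fin m => D) = expLoss ℓ h D := by
  have hint : Integrable (ℓ h) D := Integrable.of_mem_Icc 0 K hm.aemeasurable (ae_of_all D hb)
  unfold empLoss expLoss
  rw [integral_div, integral_finsetSum _ fun j _ =>
    integrable_comp_eval (μ := fun _ : Fin m => D) (i := j) hint]
  have h1 (j : Fin m) : ∫ s, ℓ h (s j) ∂(Measure.pi fun _ : Fin m => D) = ∫ z, ℓ h z ∂D :=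
    integral_comp_eval (μ := fun _ : Fin m => D) hint.aestronglyMeasurable
  have : (m : ℝ) ≠ 0 := by positivity
  simp only [h1, Finset.sum_const, Finset.card_univ, Fintype.card_fin, nsmul_eq_mul]
  field_simp

/-- Hoeffding's bound on the exponential moment of the generalization gap. -/
theorem integral_exp_gap_le {H Z : Type*} [MeasurableSpace Z] {ℓ : H → Z → ℝ} {K : ℝ}
    {h : H} (hm : Measurable (ℓ h)) (hb : ∀ z, ℓ h z ∈ Set.Icc 0 K)
    (D : Measure Z) [IsProbabilityMeasure D] {m : ℕ} (hm0 : 0 < m) (t : ℝ) :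
    ∫ s, exp (t * expLoss ℓ h D - t * empLoss ℓ h s) ∂(Measure.pi fun _ : Fin m => D) ≤
      exp (t ^ 2 * K ^ 2 / (8 * m)) := by
  have hm1 : (m : ℝ) ≠ 0 := by positivity
  have hsub : ProbabilityTheory.HasSubgaussianMGF (fun z => ℓ h z - ∫ z, ℓ h z ∂D)
      ((‖K - 0‖₊ / 2) ^ 2) D :=
    ProbabilityTheory.hasSubgaussianMGF_of_mem_Icc hm.aemeasurable (ae_of_all D hb)
  have hsub' (j : Fin m) : ProbabilityTheory.HasSubgaussianMGF
      (fun s : Fin m → Z => ℓ h (s j) - ∫ z, ℓ h z ∂D) ((‖K - 0‖₊ / 2) ^ 2)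
      (Measure.pi fun _ : Fin m => D) := by
    refine ProbabilityTheory.HasSubgaussianMGF.of_map
      (X := fun z => ℓ h z - ∫ z, ℓ h z ∂D) (Y := fun s : Fin m → Z => s j)
      (measurable_pi_apply j).aemeasurable ?_
    rwa [show (Measure.pi fun _ : Fin m => D).map (fun s => s j) = D from
      (measurePreserving_eval (fun _ : Fin m => D) j).map_eq]
  have hind := ProbabilityTheory.iIndepFun_pi (μ := fun _ : Fin m => D)
    (X := fun _ z => ℓ h z - ∫ z, ℓ h z ∂D) fun _ => (hm.sub_const _).aemeasurable
  have hsum := ProbabilityTheory.HasSubgaussianMGF.sum_of_iIndepFun hind (s := Finset.univ)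
    (c := fun _ => (‖K - 0‖₊ / 2) ^ 2) fun j _ => hsub' j
  have hmgf := hsum.mgf_le (-t / m)
  rw [ProbabilityTheory.mgf] at hmgf
  refine (integral_congr_ae (ae_of_all _ fun s => ?_)).trans_le (hmgf.trans_eq ?_)
  · simp only [expLoss, empLoss, Finset.sum_sub_distrib, Finset.sum_const, Finset.card_univ,
      Fintype.card_fin, nsmul_eq_mul]
    congr 1
    field_simp
    ring
  · congr 1
    simp only [sub_zero, Finset.sum_const, Finset.card_univ, Fintype.card_fin, nsmul_eq_mul]
    push_cast
    rw [div_pow, Real.norm_eq_abs, sq_abs]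
    field_simp
    ring

/-- Theorem (Forgetting, Generalization) for iterated empirical Gibbs posteriors (tasks indexed
`0,…,T−1`): for a non-final task `i` with `λ_i = λ_{T-1}`, if for every realization of `S_i` the
empirical task covariance
`cov_{h∼P}(e^{−λ_T L̂(h,S_i)}, e^{−∑_{j≠i} λ_j L̂(h,S_j)})` is nonnegative, then
`E_{S_i} L(Q̂_{1:T}, D_i) ≤ λ_T K²/(8 m_i) + L(P, D_i)`. -/
theorem gibbs_T_task_covariance {H Z : Type*} [MeasurableSpace H] [MeasurableSpace Z]
    (ℓ : H → Z → ℝ) (hℓ : Measurable (Function.uncurry ℓ))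
    (K : ℝ) (hb : ∀ h z, ℓ h z ∈ Set.Icc 0 K)
    (T : ℕ) (D : ℕ → Measure Z) (hD : ∀ j < T, IsProbabilityMeasure (D j))
    (P : Measure H) [IsProbabilityMeasure P]
    (m : ℕ → ℕ) (hm : ∀ j < T, 0 < m j)
    (S : (j : ℕ) → Fin (m j) → Z)
    (lam : ℕ → ℝ) (hlam : ∀ j < T, 0 < lam j)
    (i : ℕ) (hi : i < T - 1) (hlami : lam i = lam (T - 1))
    (hcov : ∀ s : Fin (m i) → Z,
      0 ≤ (∫ h, Real.exp (-(lam (T - 1) * empLoss ℓ h s)) *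
            Real.exp (-∑ j ∈ (Finset.range T).erase i,
              lam j * empLoss ℓ h (Function.update S i s j)) ∂P) -
        (∫ h, Real.exp (-(lam (T - 1) * empLoss ℓ h s)) ∂P) *
          ∫ h, Real.exp (-∑ j ∈ (Finset.range T).erase i,
            lam j * empLoss ℓ h (Function.update S i s j)) ∂P) :
    (∫ s, (∫ h, expLoss ℓ h (D i)
          ∂(iterGibbs P (fun j h => lam j * empLoss ℓ h (Function.update S i s j)) T))
        ∂(Measure.pi fun _ : Fin (m i) => D i)) ≤
      lam (T - 1) * K ^ 2 / (8 * m i) + ∫ h, expLoss ℓ h (D i) ∂P := by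
  have := hD i (by omega)
  set t := lam (T - 1)
  have ht : 0 < t := hlam _ (by omega)
  have hm0 : 0 < m i := hm i (by omega)
  have hiT : i ∈ Finset.range T := Finset.mem_range.2 (by omega)
  obtain ⟨h₀⟩ := nonempty_of_isProbabilityMeasure P
  obtain ⟨z₀⟩ := nonempty_of_isProbabilityMeasure (D i)
  have hK : 0 ≤ K := (hb h₀ z₀).1.trans (hb h₀ z₀).2
  have hℓh (h : H) : Measurable (ℓ h) := hℓ.comp measurable_prodMk_left
  have hEm : Measurable fun h => expLoss ℓ h (D i) := measurable_expLoss hℓ (D i)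
  have hEb (h : H) : expLoss ℓ h (D i) ∈ Set.Icc 0 K := expLoss_mem_Icc (hℓh h) (hb h) (D i)
  set B : H → ℝ := fun h => ∑ j ∈ (Finset.range T).erase i, lam j * empLoss ℓ h (S j)
  have hBeq (s : Fin (m i) → Z) (h : H) : ∑ j ∈ (Finset.range T).erase i,
      lam j * empLoss ℓ h (Function.update S i s j) = B h := by
    refine Finset.sum_congr rfl fun j hj => ?_
    rw [Function.update_of_ne (Finset.ne_of_mem_erase hj)]
  have hsum_mem (F : Finset ℕ) (hF : ∀ j ∈ F, j < T) (S' : (j : ℕ) → Fin (m j) → Z) (h : H) :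
      ∑ j ∈ F, lam j * empLoss ℓ h (S' j) ∈ Set.Icc 0 (∑ j ∈ F, lam j * K) :=
    ⟨Finset.sum_nonneg fun j hj =>
        mul_nonneg (hlam j (hF j hj)).le (empLoss_mem_Icc hK (hb h) _).1,
      Finset.sum_le_sum fun j hj =>
        mul_le_mul_of_nonneg_left (empLoss_mem_Icc hK (hb h) _).2 (hlam j (hF j hj)).le⟩
  have hsum_meas (F : Finset ℕ) (S' : (j : ℕ) → Fin (m j) → Z) :
      Measurable fun h => ∑ j ∈ F, lam j * empLoss ℓ h (S' j) :=
    Finset.measurable_sum _ fun j _ => (measurable_empLoss hℓ (S' j)).const_mul _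
  have hBm : Measurable B := hsum_meas _ S
  have hBb := hsum_mem ((Finset.range T).erase i)
    (fun j hj => Finset.mem_range.1 (Finset.mem_of_mem_erase hj)) S
  have hpost (s : Fin (m i) → Z) :
      iterGibbs P (fun j h => lam j * empLoss ℓ h (Function.update S i s j)) T =
        P.tilted fun h => -(t * empLoss ℓ h s + B h) := by
    rw [iterGibbs_eq_tilted P _ T fun k hk => ?_]
    · congr 1
      ext h
      rw [← Finset.add_sum_erase _ _ hiT, hBeq, Function.update_self, hlami]
    · have hmem := hsum_mem (Finset.range k)
        (fun j hj => (Finset.mem_range.1 hj).trans hk) (Function.update S i s)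
      exact integrable_exp_of_mem_Icc (hsum_meas _ (Function.update S i s)).neg
        fun h => ⟨neg_le_neg (hmem h).2, neg_le_neg (hmem h).1⟩
  set ν := P.tilted fun h => -B h
  have : IsProbabilityMeasure ν := isProbabilityMeasure_tilted
    (integrable_exp_of_mem_Icc hBm.neg fun h => ⟨neg_le_neg (hBb h).2, neg_le_neg (hBb h).1⟩)
  set k := t ^ 2 * K ^ 2 / (8 * m i) with hk_def
  set μ := Measure.pi fun _ : Fin (m i) => D i
  set W : (Fin (m i) → Z) → ℝ := fun s =>
    ∫ h, exp (t * expLoss ℓ h (D i) - t * empLoss ℓ h s) ∂ν with hW_def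
  set M : (Fin (m i) → Z) → ℝ := fun s => ∫ h, empLoss ℓ h s ∂P with hM_def
  have hpoint (s : Fin (m i) → Z) :
      ∫ h, expLoss ℓ h (D i) ∂(P.tilted fun h => -(t * empLoss ℓ h s + B h)) ≤
        (k - 1) / t + M s + exp (-k) / t * W s := by
    have hc := hcov s
    simp only [hBeq] at hc
    have h1 := integral_tilted_add_le_of_cov_nonneg P (A := fun h => t * empLoss ℓ h s) (B := B)
      (L := fun h => t * expLoss ℓ h (D i)) (a := t * K) (c := t * K)
      ((measurable_empLoss hℓ s).const_mul t) hBm (hEm.const_mul t)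
      (fun h => ⟨mul_nonneg ht.le (empLoss_mem_Icc hK (hb h) s).1,
        mul_le_mul_of_nonneg_left (empLoss_mem_Icc hK (hb h) s).2 ht.le⟩)
      hBb
      (fun h => ⟨mul_nonneg ht.le (hEb h).1, mul_le_mul_of_nonneg_left (hEb h).2 ht.le⟩) hc k
    rw [integral_const_mul, integral_const_mul] at h1
    have h2 : (k - 1) / t + M s + exp (-k) / t * W s =
        (k + t * M s - 1 + exp (-k) * W s) / t := by
      field_simp
      ring
    rw [h2, le_div_iff₀ ht, mul_comm]
    exact h1
  have hMint2 : Integrable (fun p : (Fin (m i) → Z) × H => empLoss ℓ p.2 p.1) (μ.prod P) :=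
    Integrable.of_mem_Icc 0 K
      ((measurable_uncurry_empLoss hℓ (m i)).comp measurable_swap).aemeasurable
      (ae_of_all _ fun p => empLoss_mem_Icc hK (hb p.2) p.1)
  have hWint2 : Integrable (fun p : (Fin (m i) → Z) × H =>
      exp (t * expLoss ℓ p.2 (D i) - t * empLoss ℓ p.2 p.1)) (μ.prod ν) := by
    refine integrable_exp_of_mem_Icc (a := -(t * K)) (b := t * K)
      (((hEm.comp measurable_snd).const_mul t).sub
        (((measurable_uncurry_empLoss hℓ (m i)).comp measurable_swap).const_mul t))
      fun p => ?_
    have h1 := hEb p.2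
    have h2 := empLoss_mem_Icc hK (hb p.2) p.1
    constructor
    · nlinarith [mul_nonneg ht.le h1.1, mul_le_mul_of_nonneg_left h2.2 ht.le]
    · nlinarith [mul_nonneg ht.le h2.1, mul_le_mul_of_nonneg_left h1.2 ht.le]
  have hMint : Integrable M μ := hMint2.integral_prod_left
  have hWint : Integrable W μ := hWint2.integral_prod_left
  have hMval : ∫ s, M s ∂μ = ∫ h, expLoss ℓ h (D i) ∂P := by
    rw [hM_def, integral_integral_swap hMint2]
    exact integral_congr_ae (ae_of_all _ fun h => integral_empLoss (hℓh h) (hb h) (D i) hm0)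
  have hWval : ∫ s, W s ∂μ ≤ exp k := by
    rw [hW_def, integral_integral_swap hWint2]
    have h1 := integral_mono hWint2.integral_prod_right (integrable_const (exp k))
      fun h => integral_exp_gap_le (hℓh h) (hb h) (D i) hm0 t
    simpa using h1
  simp only [hpost]
  calc ∫ s, ∫ h, expLoss ℓ h (D i) ∂(P.tilted fun h => -(t * empLoss ℓ h s + B h)) ∂μ
      ≤ ∫ s, ((k - 1) / t + M s + exp (-k) / t * W s) ∂μ :=
        integral_mono_of_nonneg (ae_of_all _ fun s => integral_nonneg fun h => (hEb h).1)
          (((integrable_const _).add hMint).add (hWint.const_mul _)) (ae_of_all _ hpoint)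
    _ = (k - 1) / t + (∫ h, expLoss ℓ h (D i) ∂P) + exp (-k) / t * ∫ s, W s ∂μ := by
        have hconst : Integrable (fun s => (k - 1) / t + M s) μ := (integrable_const _).add hMint
        rw [integral_add hconst (hWint.const_mul _),
          integral_add (integrable_const _) hMint, integral_const_mul, hMval]
        simp
    _ ≤ (k - 1) / t + (∫ h, expLoss ℓ h (D i) ∂P) + exp (-k) / t * exp k := by gcongr
    _ = t * K ^ 2 / (8 * m i) + ∫ h, expLoss ℓ h (D i) ∂P := by
        rw [div_mul_eq_mul_div, ← exp_add, neg_add_cancel, exp_zero, hk_def]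
        field_simp
        ring
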